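/- For every r ∈ ℕ there exists a constant C = C(r) > 0 such that for every real h ≥ 3 and every set H ⊆ [0,h] of integers with |H| = r, one has 𝔖(H) ≤ C·(log h)^r. -/

import Mathlib

open Finset

/-- The sieve weight Λ_R(n; H, a) = (1/a!) Σ_{d | P(n,H), d ≤ R} μ(d) (log (R/d))^a,
where P(n,H) = ∏_{h ∈ H} (n+h). -/
noncomputable def lamR (R : ℝ) (n : ℕ) (H : Finset ℕ) (a : ℕ) : ℝ :=
  (1 / (Nat.factorial a : ℝ)) *
    ∑ d ∈ (∏ h ∈ H, (n + h)).divisors.filter (fun d : ℕ => (d : ℝ) ≤ R),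
      (ArithmeticFunction.moebius d : ℝ) * (Real.log (R / d)) ^ a

/-- |Ω_H(p)|: the number of residue classes mod p occupied by the elements of H. -/
def residCard (H : Finset ℕ) (p : ℕ) : ℕ := (H.image (fun h => h % p)).card

/-- The singular series 𝔖(H) = ∏_p (1 - |Ω_H(p)|/p) (1 - 1/p)^{-|H|}. -/
noncomputable def singSeries (H : Finset ℕ) : ℝ :=
  ∏' p : Nat.Primes,
    ((1 - (residCard H (p : ℕ) : ℝ) / (p : ℕ)) * ((1 - 1 / ((p : ℕ) : ℝ)) ^ H.card)⁻¹)

/-- Chebyshev-type bound from the prime factorization of `n!`. -/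
theorem sum_log_prime_div_le {n : ℕ} (hn : 0 < n) :
    ∑ p ∈ (n + 1).primesBelow, Real.log p / p ≤ 2 * Real.log n := by
  have hn' : (0 : ℝ) < n := by exact_mod_cast hn
  have hval : ∀ p ∈ (n + 1).primesBelow, n / p ≤ (n.factorial).factorization p := by
    intro p hp
    have hpp := Nat.prime_of_mem_primesBelow hp
    rw [Nat.factorization_factorial hpp (lt_add_one (Nat.log p n))]
    have hpn : p ≤ n := Nat.lt_succ_iff.mp (Nat.lt_of_mem_primesBelow hp)
    have h1 : 1 ∈ Finset.Ico 1 (Nat.log p n + 1) := by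
      have := Nat.log_pos hpp.one_lt hpn
      simp only [Finset.mem_Ico]; omega
    simpa using Finset.single_le_sum (f := fun i => n / p ^ i) (fun _ _ => Nat.zero_le _) h1
  have hfac : ∑ p ∈ (n + 1).primesBelow, ((n.factorial).factorization p : ℝ) * Real.log p
      ≤ Real.log n.factorial := by
    rw [Real.log_nat_eq_sum_factorization, Finsupp.sum]
    refine (Finset.sum_subset_zero_on_sdiff ?_ ?_ fun _ _ => rfl).ge
    · intro p hp
      have hpp := Nat.prime_of_mem_primeFactors hp
      have hd := Nat.dvd_of_mem_primeFactors hp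
      exact Nat.mem_primesBelow.mpr ⟨Nat.lt_succ_of_le ((hpp.dvd_factorial).mp hd), hpp⟩
    · intro p hp
      have h0 := Finsupp.notMem_support_iff.mp (Finset.mem_sdiff.mp hp).2
      simp [h0]
  have hlog : Real.log n.factorial ≤ n * Real.log n := by
    rw [← Real.log_pow]
    exact Real.log_le_log (by exact_mod_cast n.factorial_pos)
      (by exact_mod_cast Nat.factorial_le_pow n)
  have hfloor : ∀ p ∈ (n + 1).primesBelow,
      n / 2 * (Real.log p / p) ≤ ((n.factorial).factorization p : ℝ) * Real.log p := by
    intro p hp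
    have hpp := Nat.prime_of_mem_primesBelow hp
    have hp0 : (0 : ℝ) < p := by exact_mod_cast hpp.pos
    have hpn : p ≤ n := Nat.lt_succ_iff.mp (Nat.lt_of_mem_primesBelow hp)
    have hl : 0 ≤ Real.log p := Real.log_natCast_nonneg p
    have h2 : n ≤ 2 * (p * (n / p)) := by
      have h3 := Nat.div_add_mod n p
      have h4 := Nat.mod_lt n hpp.pos
      have h5 : p * 1 ≤ p * (n / p) := Nat.mul_le_mul_left p (Nat.div_pos hpn hpp.pos)
      omega
    have h6 : (n : ℝ) ≤ 2 * (p * (n.factorial).factorization p) := by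
      exact_mod_cast h2.trans (by gcongr; exact hval p hp)
    have h7 : (n : ℝ) / 2 / p ≤ (n.factorial).factorization p := by
      rw [div_le_iff₀ hp0]; linarith
    calc (n : ℝ) / 2 * (Real.log p / p) = n / 2 / p * Real.log p := by ring
      _ ≤ _ := mul_le_mul_of_nonneg_right h7 hl
  have key := ((Finset.sum_le_sum hfloor).trans hfac).trans hlog
  rw [← Finset.mul_sum] at key
  have : (n : ℝ) * ∑ p ∈ (n + 1).primesBelow, Real.log p / p ≤ n * (2 * Real.log n) := by
    linarith
  exact le_of_mul_le_mul_left this hn'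

/-- The telescoping comparison behind `∑ n ^ (-(1 + δ)) ≤ 1 + 1 / δ`. -/
theorem mul_rpow_neg_le_sub {δ : ℝ} (hδ : 0 < δ) {n : ℕ} (hn : 0 < n) :
    δ * ((n : ℝ) + 1) ^ (-(1 + δ)) ≤ (n : ℝ) ^ (-δ) - ((n : ℝ) + 1) ^ (-δ) := by
  have hn0 : (0 : ℝ) < n := by exact_mod_cast hn
  have hn1 : (0 : ℝ) < (n : ℝ) + 1 := by linarith
  have hlog : Real.log n - Real.log (n + 1) ≤ -(1 / ((n : ℝ) + 1)) := by
    rw [← Real.log_div hn0.ne' hn1.ne']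
    refine (Real.log_le_sub_one_of_pos (div_pos hn0 hn1)).trans_eq ?_
    field_simp; ring
  have hratio : 1 + δ / ((n : ℝ) + 1) ≤ Real.exp (-δ * (Real.log n - Real.log (n + 1))) := by
    refine le_trans ?_ (Real.add_one_le_exp _)
    have := mul_le_mul_of_nonneg_left hlog hδ.le
    have h2 : δ * -(1 / ((n : ℝ) + 1)) = -(δ / (n + 1)) := by ring
    linarith
  have hmul : (n : ℝ) ^ (-δ) =
      ((n : ℝ) + 1) ^ (-δ) * Real.exp (-δ * (Real.log n - Real.log (n + 1))) := by
    rw [Real.rpow_def_of_pos hn0, Real.rpow_def_of_pos hn1, ← Real.exp_add]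
    congr 1; ring
  have hsplit : ((n : ℝ) + 1) ^ (-(1 + δ)) = ((n : ℝ) + 1) ^ (-δ) / (n + 1) := by
    rw [show -(1 + δ) = -δ - 1 by ring, Real.rpow_sub_one hn1.ne']
  have hpos : 0 < ((n : ℝ) + 1) ^ (-δ) := Real.rpow_pos_of_pos hn1 _
  have := mul_le_mul_of_nonneg_left hratio hpos.le
  rw [← hmul] at this
  rw [hsplit]
  have h3 : ((n : ℝ) + 1) ^ (-δ) * (1 + δ / (n + 1)) =
      ((n : ℝ) + 1) ^ (-δ) + δ * (((n : ℝ) + 1) ^ (-δ) / (n + 1)) := by ring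
  linarith

theorem sum_range_rpow_neg_le {δ : ℝ} (hδ : 0 < δ) (N : ℕ) :
    ∑ n ∈ range N, (n : ℝ) ^ (-(1 + δ)) ≤ 1 + 1 / δ := by
  have hstep : ∀ m : ℕ, ∑ n ∈ range (m + 2), (n : ℝ) ^ (-(1 + δ)) ≤
      1 + 1 / δ * (1 - ((m : ℝ) + 1) ^ (-δ)) := by
    intro m
    induction m with
    | zero =>
      have h0 : (0 : ℝ) ^ (-(1 + δ)) = 0 := Real.zero_rpow (by linarith)
      rw [zero_add, Finset.sum_range_succ, Finset.sum_range_one, Nat.cast_zero, h0]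
      simp
    | succ k ih =>
      rw [Finset.sum_range_succ]
      have h := mul_rpow_neg_le_sub hδ (Nat.succ_pos k)
      have h' := mul_le_mul_of_nonneg_left h (one_div_pos.mpr hδ).le
      rw [← mul_assoc, one_div_mul_cancel hδ.ne', one_mul] at h'
      push_cast at h' ⊢
      rw [show (k : ℝ) + 2 = k + 1 + 1 by ring]
      linarith
  have hmono : ∑ n ∈ range N, (n : ℝ) ^ (-(1 + δ)) ≤
      ∑ n ∈ range (N + 2), (n : ℝ) ^ (-(1 + δ)) :=
    Finset.sum_le_sum_of_subset_of_nonneg (Finset.range_mono (by omega))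
      fun _ _ _ => Real.rpow_nonneg (Nat.cast_nonneg _) _
  have h1 : 0 ≤ 1 / δ * ((N : ℝ) + 1) ^ (-δ) := by positivity
  have := hmono.trans (hstep N)
  linarith

/-- The completely multiplicative function `n ↦ n ^ s`. -/
noncomputable def rpowHom (s : ℝ) : ℕ →* ℝ where
  toFun n := (n : ℝ) ^ s
  map_one' := by simp
  map_mul' m n := by
    push_cast
    exact Real.mul_rpow (Nat.cast_nonneg _) (Nat.cast_nonneg _)

theorem prod_primesBelow_one_sub_rpow_inv_le {δ : ℝ} (hδ : 0 < δ) (N : ℕ) :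
    ∏ p ∈ N.primesBelow, (1 - (p : ℝ) ^ (-(1 + δ)))⁻¹ ≤ 1 + 1 / δ := by
  have hlt : ∀ {p : ℕ}, p.Prime → ‖rpowHom (-(1 + δ)) p‖ < 1 := by
    intro p hp
    change ‖(p : ℝ) ^ (-(1 + δ))‖ < 1
    rw [Real.norm_of_nonneg (Real.rpow_nonneg (Nat.cast_nonneg _) _)]
    exact Real.rpow_lt_one_of_one_lt_of_neg (by exact_mod_cast hp.one_lt) (by linarith)
  have hE := (EulerProduct.summable_and_hasSum_smoothNumbers_prod_primesBelow_geometric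
    (f := rpowHom (-(1 + δ))) hlt N).2
  have hE' : HasSum (fun m : N.smoothNumbers => (m : ℝ) ^ (-(1 + δ)))
      (∏ p ∈ N.primesBelow, (1 - (p : ℝ) ^ (-(1 + δ)))⁻¹) := hE
  rw [← hE'.tsum_eq]
  have hsum : Summable (fun n : ℕ => (n : ℝ) ^ (-(1 + δ))) :=
    Real.summable_nat_rpow.mpr (by linarith)
  have hnn : ∀ n : ℕ, 0 ≤ (n : ℝ) ^ (-(1 + δ)) := fun n => Real.rpow_nonneg (Nat.cast_nonneg _) _
  exact (hsum.tsum_subtype_le (fun n : ℕ => (n : ℝ) ^ (-(1 + δ))) N.smoothNumbers hnn).trans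
    (Real.tsum_le_of_sum_range_le hnn (sum_range_rpow_neg_le hδ))

theorem one_sub_inv_le_mul_exp {δ : ℝ} (hδ : 0 < δ) {p : ℕ} (hp : p.Prime) :
    (1 - 1 / (p : ℝ))⁻¹ ≤
      (1 - (p : ℝ) ^ (-(1 + δ)))⁻¹ * Real.exp (2 * δ * (Real.log p / p)) := by
  have hp2 : (2 : ℝ) ≤ p := by exact_mod_cast hp.two_le
  have hp0 : (0 : ℝ) < p := by linarith
  have hhalf : 1 / (p : ℝ) ≤ 1 / 2 := one_div_le_one_div_of_le two_pos hp2
  have hlt : (p : ℝ) ^ (-(1 + δ)) < 1 :=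
    Real.rpow_lt_one_of_one_lt_of_neg (by linarith) (by linarith)
  have hl : 0 ≤ δ * (Real.log p / p) :=
    mul_nonneg hδ.le (div_nonneg (Real.log_nonneg (by linarith)) hp0.le)
  have hpow : 1 / (p : ℝ) - δ * (Real.log p / p) ≤ (p : ℝ) ^ (-(1 + δ)) := by
    rw [show -(1 + δ) = -δ - 1 by ring, Real.rpow_sub_one hp0.ne', Real.rpow_def_of_pos hp0]
    have := Real.add_one_le_exp (Real.log p * -δ)
    calc 1 / (p : ℝ) - δ * (Real.log p / p) = (Real.log p * -δ + 1) / p := by ring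
      _ ≤ _ := by gcongr
  have hexp := Real.add_one_le_exp (2 * δ * (Real.log p / p))
  have h1 : (0 : ℝ) < 1 - 1 / p := by linarith
  have h2 : 0 < 1 - (p : ℝ) ^ (-(1 + δ)) := by linarith
  rw [inv_le_iff_one_le_mul₀ h1, inv_mul_eq_div, div_mul_eq_mul_div, one_le_div h2]
  calc 1 - (p : ℝ) ^ (-(1 + δ)) ≤ (2 * δ * (Real.log p / p) + 1) * (1 - 1 / p) := by nlinarith
    _ ≤ _ := by gcongr

/-- The upper bound in the third theorem of Mertens, up to a constant. -/
theorem prod_primesBelow_one_sub_inv_le {n : ℕ} (hn : 3 ≤ n) :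
    ∏ p ∈ (n + 1).primesBelow, (1 - 1 / (p : ℝ))⁻¹ ≤ 2 * Real.exp 4 * Real.log n := by
  have hlog : 1 ≤ Real.log n := by
    rw [Real.le_log_iff_exp_le (by positivity)]
    have : (3 : ℝ) ≤ n := by exact_mod_cast hn
    linarith [Real.exp_one_lt_d9]
  have hδ : 0 < 1 / Real.log n := by positivity
  have hprod : ∏ p ∈ (n + 1).primesBelow, (1 - 1 / (p : ℝ))⁻¹ ≤
      ∏ p ∈ (n + 1).primesBelow, ((1 - (p : ℝ) ^ (-(1 + 1 / Real.log n)))⁻¹ *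
        Real.exp (2 * (1 / Real.log n) * (Real.log p / p))) := by
    refine Finset.prod_le_prod (fun p hp => ?_)
      fun p hp => one_sub_inv_le_mul_exp hδ (Nat.prime_of_mem_primesBelow hp)
    exact inv_nonneg.mpr (sub_nonneg.mpr (by simpa using Nat.cast_inv_le_one p))
  rw [Finset.prod_mul_distrib, ← Real.exp_sum, ← Finset.mul_sum] at hprod
  have hexp : 2 * (1 / Real.log n) * ∑ p ∈ (n + 1).primesBelow, Real.log p / p ≤ 4 :=
    calc _ ≤ 2 * (1 / Real.log n) * (2 * Real.log n) := by
          gcongr; exact sum_log_prime_div_le (by omega)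
      _ = 4 := by field_simp; norm_num
  calc _ ≤ _ := hprod
    _ ≤ (1 + 1 / (1 / Real.log n)) * Real.exp 4 := by
        gcongr; exact prod_primesBelow_one_sub_rpow_inv_le hδ _
    _ ≤ (2 * Real.log n) * Real.exp 4 := by
        gcongr; rw [one_div_one_div]; linarith
    _ = _ := by ring

theorem residCard_le {H : Finset ℕ} {p : ℕ} (hp : 0 < p) : residCard H p ≤ p := by
  have : H.image (fun h => h % p) ⊆ range p := by
    intro x hx
    obtain ⟨a, -, rfl⟩ := Finset.mem_image.mp hx
    exact Finset.mem_range.mpr (Nat.mod_lt a hp)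
  simpa [residCard] using Finset.card_le_card this

theorem residCard_eq_card {H : Finset ℕ} {p : ℕ} (hH : ∀ a ∈ H, a < p) :
    residCard H p = H.card := by
  refine Finset.card_image_of_injOn fun a ha b hb hab => ?_
  simpa [Nat.mod_eq_of_lt (hH a ha), Nat.mod_eq_of_lt (hH b hb)] using hab

theorem singSeries_factor_nonneg (H : Finset ℕ) {p : ℕ} (hp : p.Prime) :
    0 ≤ (1 - (residCard H p : ℝ) / p) * ((1 - 1 / (p : ℝ)) ^ H.card)⁻¹ := by
  have hle : (residCard H p : ℝ) / p ≤ 1 :=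
    div_le_one_of_le₀ (by exact_mod_cast residCard_le hp.pos) (Nat.cast_nonneg _)
  have : 1 / (p : ℝ) ≤ 1 := by simpa using Nat.cast_inv_le_one p
  exact mul_nonneg (by linarith) (inv_nonneg.mpr (pow_nonneg (by linarith) _))

theorem singSeries_factor_le (H : Finset ℕ) {N p : ℕ} (hp : p.Prime) (hH : ∀ a ∈ H, a ≤ N) :
    (1 - (residCard H p : ℝ) / p) * ((1 - 1 / (p : ℝ)) ^ H.card)⁻¹ ≤
      if p ≤ N then (1 - 1 / (p : ℝ))⁻¹ ^ H.card else 1 := by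
  have h1 : 1 / (p : ℝ) < 1 := by
    rw [div_lt_one (by exact_mod_cast hp.pos)]; exact_mod_cast hp.one_lt
  have hpos : 0 < (1 - 1 / (p : ℝ)) ^ H.card := pow_pos (by linarith) _
  split_ifs with hpN
  · rw [inv_pow]
    refine mul_le_of_le_one_left (inv_nonneg.mpr hpos.le) ?_
    have : 0 ≤ (residCard H p : ℝ) / p := by positivity
    linarith
  · rw [residCard_eq_card fun a ha => (hH a ha).trans_lt (not_le.mp hpN),
      mul_inv_le_iff₀ hpos, one_mul]
    have := one_add_mul_le_pow (a := -(1 / (p : ℝ))) (by linarith) H.card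
    rw [← sub_eq_add_neg] at this
    refine le_trans (le_of_eq ?_) this
    ring

theorem prod_singSeries_factor_le (H : Finset ℕ) {N : ℕ} (hH : ∀ a ∈ H, a ≤ N)
    (s : Finset Nat.Primes) :
    ∏ p ∈ s, ((1 - (residCard H (p : ℕ) : ℝ) / (p : ℕ)) *
        ((1 - 1 / ((p : ℕ) : ℝ)) ^ H.card)⁻¹) ≤
      (∏ p ∈ (N + 1).primesBelow, (1 - 1 / (p : ℝ))⁻¹) ^ H.card := by
  refine (Finset.prod_le_prod (fun p _ => singSeries_factor_nonneg H p.2)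
    fun p _ => singSeries_factor_le H p.2 hH).trans ?_
  have hmap : ∏ p ∈ s, (if (p : ℕ) ≤ N then (1 - 1 / ((p : ℕ) : ℝ))⁻¹ ^ H.card else 1) =
      ∏ p ∈ (s.map ⟨((↑) : Nat.Primes → ℕ), Nat.Primes.coe_nat_injective⟩).filter (· ≤ N),
        (1 - 1 / (p : ℝ))⁻¹ ^ H.card := by
    rw [Finset.prod_filter]
    exact (Finset.prod_map s ⟨((↑) : Nat.Primes → ℕ), Nat.Primes.coe_nat_injective⟩
      fun p : ℕ => if p ≤ N then (1 - 1 / (p : ℝ))⁻¹ ^ H.card else 1).symm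
  rw [hmap, ← Finset.prod_pow]
  have hsub : (s.map ⟨((↑) : Nat.Primes → ℕ), Nat.Primes.coe_nat_injective⟩).filter (· ≤ N) ⊆ (N + 1).primesBelow := by
    intro p hp
    obtain ⟨hp, hpN⟩ := Finset.mem_filter.mp hp
    obtain ⟨q, -, rfl⟩ := Finset.mem_map.mp hp
    exact Nat.mem_primesBelow.mpr ⟨Nat.lt_succ_of_le hpN, q.2⟩
  have hone : ∀ p ∈ (N + 1).primesBelow, 1 ≤ (1 - 1 / (p : ℝ))⁻¹ ^ H.card := by
    intro p hp
    have hpp := Nat.prime_of_mem_primesBelow hp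
    have h1 : 1 / (p : ℝ) < 1 := by
      rw [div_lt_one (by exact_mod_cast hpp.pos)]; exact_mod_cast hpp.one_lt
    have h0 : 0 ≤ 1 / (p : ℝ) := by positivity
    exact one_le_pow₀ (one_le_inv₀ (by linarith) |>.mpr (by linarith))
  exact Finset.prod_le_prod_of_subset_of_one_le hsub
    (fun p hp => zero_le_one.trans (hone p (hsub hp))) fun p hp _ => hone p hp

/-- The singular series of a set H ⊆ [0,h] of size r is O_r((log h)^r). -/
theorem singSeries_le (r : ℕ) :
    ∃ C : ℝ, 0 < C ∧
      ∀ h : ℝ, 3 ≤ h → ∀ H : Finset ℕ, H.card = r → (∀ a ∈ H, (a : ℝ) ≤ h) →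
        singSeries H ≤ C * (Real.log h) ^ r := by
  refine ⟨(2 * Real.exp 4) ^ r, by positivity, ?_⟩
  rintro h hh H rfl hH
  have hN : 3 ≤ ⌊h⌋₊ := Nat.le_floor (by exact_mod_cast hh)
  have hHN : ∀ a ∈ H, a ≤ ⌊h⌋₊ := fun a ha => Nat.le_floor (hH a ha)
  have hlog : 1 ≤ Real.log h := by
    rw [Real.le_log_iff_exp_le (by linarith)]
    linarith [Real.exp_one_lt_d9]
  have hfloor : Real.log ⌊h⌋₊ ≤ Real.log h :=
    Real.log_le_log (by exact_mod_cast (by omega : 0 < ⌊h⌋₊)) (Nat.floor_le (by linarith))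
  rw [← mul_pow]
  by_cases hm : Multipliable fun p : Nat.Primes =>
      ((1 - (residCard H (p : ℕ) : ℝ) / (p : ℕ)) * ((1 - 1 / ((p : ℕ) : ℝ)) ^ H.card)⁻¹)
  · refine hasProd_le_of_prod_le hm.hasProd fun s => ?_
    refine (prod_singSeries_factor_le H hHN s).trans (pow_le_pow_left₀ ?_ ?_ _)
    · refine Finset.prod_nonneg fun p _ => inv_nonneg.mpr (sub_nonneg.mpr ?_)
      simpa using Nat.cast_inv_le_one p
    · exact (prod_primesBelow_one_sub_inv_le hN).trans (by gcongr)
  · rw [singSeries, tprod_eq_one_of_not_multipliable hm]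
    have := Real.one_le_exp (show (0 : ℝ) ≤ 4 by norm_num)
    exact one_le_pow₀ (by nlinarith)
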